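/- Let F : A → (0,∞) and F̂ : Â → (0,∞) be pseudo-Minkowski norms on V and w ∈ V, and suppose F̂ is a translation of F by w, i.e. F(v/F̂(v) − w) = 1 for every v ∈ Â. Let u ∈ Â, set ξ = ℒ_{F̂}(u), v = u/F̂(u) − w, and μ = F̂(u) − ξ(w), and assume μ > 0 (the straight case). Then ℒ_F(μ·v) = ξ and F(μ·v) = μ; consequently the Legendre duals satisfy F̂*(ξ) = F*(ξ) + ξ(w), i.e. F̂(u) = F(μ·v) + ξ(w). -/

import Mathlib

/-- The fundamental tensor of a pseudo-Minkowski norm `F` at `v`. -/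
noncomputable def fundTensor {V : Type*} [NormedAddCommGroup V] [NormedSpace ℝ V]
    (F : V → ℝ) (v u w : V) : ℝ :=
  (1 / 2) * deriv (fun t : ℝ => deriv (fun s : ℝ => (F (v + t • u + s • w)) ^ 2) 0) 0

/-- A (conic) pseudo-Minkowski norm on `V` with domain `A`. -/
structure IsPseudoMinkowski {V : Type*} [NormedAddCommGroup V] [NormedSpace ℝ V]
    (A : Set V) (F : V → ℝ) : Prop where
  isOpen : IsOpen A
  zero_not_mem : (0 : V) ∉ A
  conic : ∀ v ∈ A, ∀ l : ℝ, 0 < l → l • v ∈ A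
  smooth : ContDiffOn ℝ (⊤ : ℕ∞) F A
  pos : ∀ v ∈ A, 0 < F v
  homog : ∀ v ∈ A, ∀ l : ℝ, 0 < l → F (l • v) = l * F v
  nondeg : ∀ v ∈ A, ∀ u : V, (∀ w : V, fundTensor F v u w = 0) → u = 0

namespace IsPseudoMinkowski

variable {V : Type*} [NormedAddCommGroup V] [NormedSpace ℝ V] {A : Set V} {F : V → ℝ}

theorem hasFDerivAt (hF : IsPseudoMinkowski A F) {x : V} (hx : x ∈ A) :
    HasFDerivAt F (fderiv ℝ F x) x :=
  ((hF.smooth.contDiffAt (hF.isOpen.mem_nhds hx)).differentiableAt (by simp)).hasFDerivAt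

/-- The differential of a positively 1-homogeneous function is positively 0-homogeneous. -/
theorem fderiv_smul (hF : IsPseudoMinkowski A F) {x : V} (hx : x ∈ A) {l : ℝ} (hl : 0 < l) :
    fderiv ℝ F (l • x) = fderiv ℝ F x := by
  have h1 : HasFDerivAt (fun y : V => F (l • y)) (l • fderiv ℝ F (l • x)) x := by
    have h := (hF.hasFDerivAt (hF.conic x hx l hl)).comp x ((hasFDerivAt_id x).const_smul l)
    rwa [ContinuousLinearMap.comp_smul, ContinuousLinearMap.comp_id] at h
  have h2 : HasFDerivAt (fun y : V => F (l • y)) (l • fderiv ℝ F x) x := by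
    refine ((hF.hasFDerivAt hx).const_smul l).congr_of_eventuallyEq ?_
    filter_upwards [hF.isOpen.mem_nhds hx] with y hy
    simpa using hF.homog y hy l hl
  exact smul_right_injective _ hl.ne' (h1.unique h2)

/-- Euler's identity. -/
theorem fderiv_self (hF : IsPseudoMinkowski A F) {x : V} (hx : x ∈ A) :
    fderiv ℝ F x x = F x := by
  have h1 : HasDerivAt (fun t : ℝ => F (t • x)) (fderiv ℝ F x x) 1 := by
    have h : HasFDerivAt F (fderiv ℝ F x) ((1 : ℝ) • x) := by
      simpa using hF.hasFDerivAt hx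
    have hc : HasDerivAt (fun t : ℝ => t • x) x 1 := by
      simpa using (hasDerivAt_id (1 : ℝ)).smul_const x
    exact h.comp_hasDerivAt 1 hc
  have h2 : HasDerivAt (fun t : ℝ => F (t • x)) (F x) 1 := by
    have h : HasDerivAt (fun t : ℝ => t * F x) (F x) 1 := by
      simpa using (hasDerivAt_id (1 : ℝ)).mul_const (F x)
    refine h.congr_of_eventuallyEq ?_
    filter_upwards [lt_mem_nhds (zero_lt_one : (0 : ℝ) < 1)] with t ht
    exact hF.homog x hx t ht
  exact h1.unique h2

/-- The Legendre transformation of `F` is half the differential of `F ^ 2`. -/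
theorem fundTensor_self (hF : IsPseudoMinkowski A F) {x : V} (hx : x ∈ A) (z : V) :
    fundTensor F x x z = F x * fderiv ℝ F x z := by
  have inner : ∀ t : ℝ, -1 < t →
      deriv (fun s : ℝ => (F (x + t • x + s • z)) ^ 2) 0
        = (1 + t) * (2 * F x * fderiv ℝ F x z) := by
    intro t ht
    have ht' : 0 < 1 + t := by linarith
    have e : x + t • x = (1 + t) • x := by rw [add_smul, one_smul]
    have hd : HasFDerivAt F (fderiv ℝ F x) (x + t • x + (0 : ℝ) • z) := by
      rw [zero_smul, add_zero, e, ← hF.fderiv_smul hx ht']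
      exact hF.hasFDerivAt (hF.conic x hx _ ht')
    have hc : HasDerivAt (fun s : ℝ => x + t • x + s • z) z 0 := by
      simpa using ((hasDerivAt_id (0 : ℝ)).smul_const z).const_add (x + t • x)
    have h : HasDerivAt (fun s : ℝ => (F (x + t • x + s • z)) ^ 2) _ 0 :=
      (hd.comp_hasDerivAt 0 hc).pow 2
    rw [h.deriv]
    simp only [zero_smul, add_zero, e, hF.homog x hx _ ht']
    push_cast
    ring
  have outer : HasDerivAt
      (fun t : ℝ => deriv (fun s : ℝ => (F (x + t • x + s • z)) ^ 2) 0)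
      (2 * F x * fderiv ℝ F x z) 0 := by
    have h : HasDerivAt (fun t : ℝ => (1 + t) * (2 * F x * fderiv ℝ F x z))
        (2 * F x * fderiv ℝ F x z) 0 := by
      simpa using ((hasDerivAt_id (0 : ℝ)).const_add 1).mul_const (2 * F x * fderiv ℝ F x z)
    refine h.congr_of_eventuallyEq ?_
    filter_upwards [lt_mem_nhds (by norm_num : (-1 : ℝ) < 0)] with t ht
    exact inner t ht
  rw [fundTensor, outer.deriv]
  ring

/-- If `Fh` is a translation of `F` by `w`, the differentials of `F` and `Fh` at corresponding
points of the indicatrices are proportional. -/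
theorem fderiv_of_translation {Ah : Set V} {Fh : V → ℝ}
    (hF : IsPseudoMinkowski A F) (hFh : IsPseudoMinkowski Ah Fh) {w : V}
    (htrans : ∀ v ∈ Ah, (Fh v)⁻¹ • v - w ∈ A ∧ F ((Fh v)⁻¹ • v - w) = 1)
    {u v : V} (hu : u ∈ Ah) (hv : v = (Fh u)⁻¹ • u - w) (z : V) :
    fderiv ℝ F v z = fderiv ℝ Fh u z * (1 + fderiv ℝ F v w) := by
  obtain ⟨hvA, hv1⟩ := htrans u hu
  rw [← hv] at hvA hv1
  have hne : Fh u ≠ 0 := (hFh.pos u hu).ne'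
  have hc : HasDerivAt (fun s : ℝ => u + s • z) z 0 := by
    simpa using ((hasDerivAt_id (0 : ℝ)).smul_const z).const_add u
  have hinv : HasDerivAt (fun s : ℝ => (Fh (u + s • z))⁻¹)
      (-(fderiv ℝ Fh u z) / Fh u ^ 2) 0 := by
    have hd : HasFDerivAt Fh (fderiv ℝ Fh u) (u + (0 : ℝ) • z) := by
      simpa using hFh.hasFDerivAt hu
    simpa using (hd.comp_hasDerivAt 0 hc).fun_inv (by simpa using hne)
  have hp : HasDerivAt (fun s : ℝ => (Fh (u + s • z))⁻¹ • (u + s • z) - w)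
      ((Fh u)⁻¹ • z + (-(fderiv ℝ Fh u z) / Fh u ^ 2) • u) 0 := by
    simpa using (hinv.fun_smul hc).sub_const w
  have hd : HasFDerivAt F (fderiv ℝ F v)
      ((Fh (u + (0 : ℝ) • z))⁻¹ • (u + (0 : ℝ) • z) - w) := by
    simpa [← hv] using hF.hasFDerivAt hvA
  have hconst : HasDerivAt (fun s : ℝ => F ((Fh (u + s • z))⁻¹ • (u + s • z) - w)) 0 0 := by
    refine (hasDerivAt_const (0 : ℝ) (1 : ℝ)).congr_of_eventuallyEq ?_
    have hmem : Ah ∈ nhds (u + (0 : ℝ) • z) := by simpa using hFh.isOpen.mem_nhds hu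
    filter_upwards [hc.continuousAt.preimage_mem_nhds hmem] with s hs
    exact (htrans _ hs).2
  have key := (hd.comp_hasDerivAt 0 hp).unique hconst
  have hu' : u = Fh u • (v + w) := by
    rw [hv, sub_add_cancel, smul_smul, mul_inv_cancel₀ hne, one_smul]
  have hdu : fderiv ℝ F v u = Fh u * (1 + fderiv ℝ F v w) := by
    conv_lhs => rw [hu']
    rw [map_smul, map_add, hF.fderiv_self hvA, hv1, smul_eq_mul]
  rw [map_add, map_smul, map_smul, hdu, smul_eq_mul, smul_eq_mul] at key
  field_simp at key
  linarith

end IsPseudoMinkowski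

/-- Straight case of the dual description of a translation. Suppose `Fh` is a
translation of `F` by `w`, i.e. `F(v/Fh(v) − w) = 1` for all `v` in the domain of
`Fh`. Given `u` in the domain of `Fh`, set `ξ = ℒ_{Fh}(u) = g^{Fh}_u(u,·)`,
`v = u/Fh(u) − w` and `μ = Fh(u) − ξ(w)`, and assume `μ > 0`. Then `μ·v` lies in
the domain of `F`, `ℒ_F(μv) = ξ`, `F(μv) = μ`, and the Legendre duals satisfy
`Fh*(ξ) = F*(ξ) + ξ(w)`, i.e. `Fh(u) = F(μv) + ξ(w)`. -/
theorem stmt13 {V : Type*} [NormedAddCommGroup V] [NormedSpace ℝ V] [FiniteDimensional ℝ V]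
    {A Ah : Set V} {F Fh : V → ℝ}
    (hF : IsPseudoMinkowski A F) (hFh : IsPseudoMinkowski Ah Fh) (w : V)
    (htrans : ∀ v ∈ Ah, (Fh v)⁻¹ • v - w ∈ A ∧ F ((Fh v)⁻¹ • v - w) = 1)
    {u : V} (hu : u ∈ Ah)
    {v : V} (hv : v = (Fh u)⁻¹ • u - w)
    {μ : ℝ} (hμ : μ = Fh u - fundTensor Fh u u w)
    (hμpos : 0 < μ) :
    μ • v ∈ A
      ∧ (∀ z : V, fundTensor F (μ • v) (μ • v) z = fundTensor Fh u u z)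
      ∧ F (μ • v) = μ
      ∧ Fh u = F (μ • v) + fundTensor Fh u u w := by
  obtain ⟨hvA, hv1⟩ := htrans u hu
  rw [← hv] at hvA hv1
  have hFμ : F (μ • v) = μ := by rw [hF.homog v hvA μ hμpos, hv1, mul_one]
  have hμA := hF.conic v hvA μ hμpos
  refine ⟨hμA, fun z => ?_, hFμ, by rw [hFμ, hμ]; ring⟩
  rw [hF.fundTensor_self hμA, hFμ, hF.fderiv_smul hvA hμpos, hFh.fundTensor_self hu]
  rw [hFh.fundTensor_self hu] at hμ
  have hz := hF.fderiv_of_translation hFh htrans hu hv z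
  have hw := hF.fderiv_of_translation hFh htrans hu hv w
  rw [hz, hμ]
  linear_combination Fh u * fderiv ℝ Fh u z * hw
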